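/- The subgroup (K₁ + K₂) ∩ K₃ of G contains exactly gcd(μ₁, μ₂) elements; moreover it is cyclic, generated by the class of (1/γ)·w₁ + (ξ_γ/γ)·w₂ for a unique ξ_γ ∈ {0, …, γ−1} coprime to γ, where γ = gcd(μ₁, μ₂). -/

import Mathlib

noncomputable section

/-- The coercion of an integer vector in `ℤ³` to `ℝ³`. -/
def coe3 (v : Fin 3 → ℤ) : Fin 3 → ℝ := fun i => (v i : ℝ)

/-- A vector of `ℤ³` is primitive if the greatest common divisor of its components is 1. -/
def IsPrimitive (v : Fin 3 → ℤ) : Prop := Int.gcd (v 0) (Int.gcd (v 1) (v 2)) = 1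

/-- The fundamental parallelepiped spanned by two vectors:
`◊(a,b) = {s•a + t•b : s,t ∈ [0,1)}`. -/
def para2 (a b : Fin 3 → ℝ) : Set (Fin 3 → ℝ) :=
  {x | ∃ s t : ℝ, 0 ≤ s ∧ s < 1 ∧ 0 ≤ t ∧ t < 1 ∧ x = s • a + t • b}

/-- The fundamental parallelepiped spanned by three vectors:
`◊(a,b,c) = {s•a + t•b + u•c : s,t,u ∈ [0,1)}`. -/
def para3 (a b c : Fin 3 → ℝ) : Set (Fin 3 → ℝ) :=
  {x | ∃ s t u : ℝ, 0 ≤ s ∧ s < 1 ∧ 0 ≤ t ∧ t < 1 ∧ 0 ≤ u ∧ u < 1 ∧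
    x = s • a + t • b + u • c}

/-- The integral points `ℤ³ ∩ ◊(a,b)` of a two-dimensional fundamental parallelepiped. -/
def H2pts (a b : Fin 3 → ℤ) : Set (Fin 3 → ℤ) := {x | coe3 x ∈ para2 (coe3 a) (coe3 b)}

/-- The integral points `ℤ³ ∩ ◊(a,b,c)` of a three-dimensional fundamental parallelepiped. -/
def H3pts (a b c : Fin 3 → ℤ) : Set (Fin 3 → ℤ) :=
  {x | coe3 x ∈ para3 (coe3 a) (coe3 b) (coe3 c)}

/-- The subgroup `ℤ³ ∩ (ℝa + ℝb)` of `ℤ³` of integral points of the plane spanned by `a, b`. -/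
def planeSubgroup (a b : Fin 3 → ℝ) : AddSubgroup (Fin 3 → ℤ) where
  carrier := {x | ∃ s t : ℝ, coe3 x = s • a + t • b}
  zero_mem' := ⟨0, 0, by funext i; simp [coe3]⟩
  add_mem' := by
    rintro x y ⟨s, t, hx⟩ ⟨u, v, hy⟩
    refine ⟨s + u, t + v, ?_⟩
    funext i
    have h1 := congrFun hx i
    have h2 := congrFun hy i
    simp only [coe3, Pi.add_apply, Pi.smul_apply, smul_eq_mul, Int.cast_add] at h1 h2 ⊢
    rw [h1, h2]; ring
  neg_mem' := by
    rintro x ⟨s, t, hx⟩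
    refine ⟨-s, -t, ?_⟩
    funext i
    have h1 := congrFun hx i
    simp only [coe3, Pi.add_apply, Pi.neg_apply, Pi.smul_apply, smul_eq_mul,
      Int.cast_neg, neg_smul] at h1 ⊢
    rw [h1]; ring

/-- The lattice `Λ = ℤw₁ + ℤw₂ + ℤw₃`. -/
def lattice3 (w₁ w₂ w₃ : Fin 3 → ℤ) : AddSubgroup (Fin 3 → ℤ) :=
  AddSubgroup.closure {w₁, w₂, w₃}

/-- The finite abelian group `G = ℤ³/Λ`. -/
abbrev Gquot (w₁ w₂ w₃ : Fin 3 → ℤ) := (Fin 3 → ℤ) ⧸ lattice3 w₁ w₂ w₃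

/-- The subgroup `K` of `G = ℤ³/Λ` given by the image of `ℤ³ ∩ (ℝa + ℝb)`. -/
def Ksub (w₁ w₂ w₃ a b : Fin 3 → ℤ) : AddSubgroup (Gquot w₁ w₂ w₃) :=
  AddSubgroup.map (QuotientAddGroup.mk' (lattice3 w₁ w₂ w₃)) (planeSubgroup (coe3 a) (coe3 b))

theorem coe3_add (x y : Fin 3 → ℤ) : coe3 (x + y) = coe3 x + coe3 y := by
  funext i; simp [coe3]

theorem coe3_smul (k : ℤ) (x : Fin 3 → ℤ) : coe3 (k • x) = (k : ℝ) • coe3 x := by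
  funext i; simp [coe3]

theorem coe3_inj {x y : Fin 3 → ℤ} (h : coe3 x = coe3 y) : x = y := by
  funext i
  have := congrFun h i
  simpa [coe3] using this

theorem prim_bezout {b : Fin 3 → ℤ} (hb : IsPrimitive b) :
    ∃ p q r : ℤ, p * b 0 + q * b 1 + r * b 2 = 1 := by
  unfold IsPrimitive at hb
  have h1 := Int.gcd_eq_gcd_ab (b 0) (Int.gcd (b 1) (b 2))
  have h2 := Int.gcd_eq_gcd_ab (b 1) (b 2)
  rw [hb] at h1
  generalize Int.gcdA (b 0) (Int.gcd (b 1) (b 2)) = p at h1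
  generalize Int.gcdB (b 0) (Int.gcd (b 1) (b 2)) = q at h1
  refine ⟨p, q * Int.gcdA (b 1) (b 2), q * Int.gcdB (b 1) (b 2), ?_⟩
  push_cast at h1
  linear_combination (-1 : ℤ) * h1 - q * h2

theorem prim_real {b v : Fin 3 → ℤ} (hb : IsPrimitive b) {t : ℝ}
    (h : t • coe3 b = coe3 v) : ∃ k : ℤ, t = k := by
  obtain ⟨p, q, r, h1⟩ := prim_bezout hb
  refine ⟨p * v 0 + q * v 1 + r * v 2, ?_⟩
  have e0 := congrFun h 0
  have e1 := congrFun h 1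
  have e2 := congrFun h 2
  simp only [coe3, Pi.smul_apply, smul_eq_mul] at e0 e1 e2
  have h1' : (p : ℝ) * b 0 + q * b 1 + r * b 2 = 1 := by exact_mod_cast h1
  push_cast
  rw [← e0, ← e1, ← e2]
  linear_combination (-t) * h1'

theorem prim_int {b v : Fin 3 → ℤ} (hb : IsPrimitive b) {n k : ℤ}
    (h : n • v = k • b) : n ∣ k := by
  obtain ⟨p, q, r, h1⟩ := prim_bezout hb
  refine ⟨p * v 0 + q * v 1 + r * v 2, ?_⟩
  have e0 := congrFun h 0
  have e1 := congrFun h 1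
  have e2 := congrFun h 2
  simp only [Pi.smul_apply, smul_eq_mul] at e0 e1 e2
  linear_combination (-k) * h1 - p * e0 - q * e1 - r * e2

theorem prim_coprime {a b e : Fin 3 → ℤ} (ha : IsPrimitive a) {n c : ℤ}
    (h : n • e = a + c • b) : IsCoprime c n := by
  rw [Int.isCoprime_iff_gcd_eq_one]
  obtain ⟨c', hc⟩ : (Int.gcd c n : ℤ) ∣ c := Int.gcd_dvd_left ..
  obtain ⟨n', hn⟩ : (Int.gcd c n : ℤ) ∣ n := Int.gcd_dvd_right ..
  set g := Int.gcd c n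
  have : (g : ℤ) ∣ 1 := by
    apply prim_int (v := n' • e - c' • b) ha
    rw [one_smul, smul_sub, smul_smul, smul_smul, ← hc, ← hn, h]
    abel
  exact_mod_cast Int.eq_one_of_dvd_one (by positivity) this

/-- A basis of the plane lattice adapted to the primitive vector `b`. -/
theorem plane_basis {a b : Fin 3 → ℤ} (ha : IsPrimitive a) (hb : IsPrimitive b)
    (hind : ∀ s t : ℝ, s • coe3 a + t • coe3 b = 0 → s = 0 ∧ t = 0) :
    ∃ (n : ℕ) (e : Fin 3 → ℤ) (c : ℤ), 0 < n ∧ (n : ℤ) • e = a + c • b ∧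
      ∀ x ∈ planeSubgroup (coe3 a) (coe3 b), ∃ k m : ℤ, x = k • e + m • b := by
  have hminor : ∃ i j : Fin 3, a i * b j - a j * b i ≠ 0 := by
    by_contra! hcon
    have hz : ∀ i, a i = 0 := by
      intro i
      have := hind (b i) (-(a i : ℝ)) (by
        funext j
        have := hcon i j
        have : (a i : ℝ) * b j - a j * b i = 0 := by exact_mod_cast this
        simp only [coe3, Pi.add_apply, Pi.smul_apply, smul_eq_mul, Pi.zero_apply]
        linarith)
      have := this.2
      simpa using this
    simp [IsPrimitive, hz] at ha
  obtain ⟨i, j, hd⟩ := hminor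
  set d : ℤ := a i * b j - a j * b i with hddef
  let S : AddSubgroup ℤ :=
    { carrier := {k | ∃ (x : Fin 3 → ℤ) (l : ℤ), d • x = k • a + l • b}
      zero_mem' := ⟨0, 0, by simp⟩
      add_mem' := by
        rintro k k' ⟨x, l, h⟩ ⟨x', l', h'⟩
        refine ⟨x + x', l + l', ?_⟩
        rw [smul_add, h, h', add_smul, add_smul]; abel
      neg_mem' := by
        rintro k ⟨x, l, h⟩
        refine ⟨-x, -l, ?_⟩
        rw [smul_neg, h, neg_smul, neg_smul]; abel }
  obtain ⟨g, hg⟩ := Int.subgroup_cyclic S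
  have hgS : g ∈ S := by rw [hg]; exact AddSubgroup.subset_closure rfl
  have hdS : d ∈ S := ⟨a, 0, by simp⟩
  have hdvd : ∀ k ∈ S, g ∣ k := by
    intro k hk
    rw [hg, AddSubgroup.mem_closure_singleton] at hk
    obtain ⟨z, hz⟩ := hk
    exact ⟨z, by rw [← hz, smul_eq_mul, mul_comm]⟩
  obtain ⟨n, hn⟩ := hdvd d hdS
  have hg0 : g ≠ 0 := by rintro rfl; simp at hn; exact hd hn
  have hn0 : n ≠ 0 := by rintro rfl; simp at hn; exact hd hn
  obtain ⟨e, l, he⟩ := hgS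
  -- `n • e = a + c • b`
  have hl : g ∣ l := by
    apply prim_int (v := n • e - a) hb
    rw [smul_sub, smul_smul, ← hn, he]; abel
  obtain ⟨c, hc⟩ := hl
  have hne : n • e = a + c • b := by
    have : g • (n • e) = g • (a + c • b) := by
      rw [smul_smul, ← hn, he, hc, smul_add, smul_smul]
    exact smul_right_injective _ hg0 this
  have hspan : ∀ x ∈ planeSubgroup (coe3 a) (coe3 b), ∃ k m : ℤ, x = k • e + m • b := by
    rintro x ⟨s, t, hx⟩
    have hsd : (d : ℝ) * s = ((x i * b j - x j * b i : ℤ) : ℝ) := by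
      have h1 := congrFun hx i
      have h2 := congrFun hx j
      simp only [coe3, Pi.add_apply, Pi.smul_apply, smul_eq_mul] at h1 h2
      rw [hddef]; push_cast; rw [h1, h2]; ring
    set k : ℤ := x i * b j - x j * b i
    obtain ⟨l', hl'⟩ : ∃ l' : ℤ, (d : ℝ) * t = l' := by
      apply prim_real (v := d • x + (-k) • a) hb
      rw [coe3_add, coe3_smul, coe3_smul, hx, Int.cast_neg, ← hsd, smul_add, smul_smul, smul_smul,
        neg_smul]
      abel
    have hkS : k ∈ S := ⟨x, l', by
      apply coe3_inj
      rw [coe3_add, coe3_smul, coe3_smul, coe3_smul, hx, smul_add, smul_smul, smul_smul, hsd, hl']⟩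
    obtain ⟨z, hz⟩ := hdvd k hkS
    have hxz : d • (x - z • e) = (l' - z * l) • b := by
      have h1 : d • x = k • a + l' • b := by
        apply coe3_inj
        rw [coe3_add, coe3_smul, coe3_smul, coe3_smul, hx, smul_add, smul_smul, smul_smul, hsd, hl']
      rw [smul_sub, h1, smul_comm, he, hz]
      module
    obtain ⟨m, hm⟩ := prim_int hb hxz
    refine ⟨z, m, ?_⟩
    have : d • (x - z • e) = d • (m • b) := by rw [hxz, hm, smul_smul]
    have := smul_right_injective _ hd this
    rw [← this]; abel
  rcases lt_or_gt_of_ne hn0 with h | h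
  · refine ⟨n.natAbs, -e, c, by omega, ?_, ?_⟩
    · rw [← hne]
      have : ((n.natAbs : ℕ) : ℤ) = -n := by omega
      rw [this]; simp
    · intro x hx
      obtain ⟨k, m, h⟩ := hspan x hx
      exact ⟨-k, m, by rw [h]; simp⟩
  · refine ⟨n.natAbs, e, c, by omega, ?_, hspan⟩
    have : ((n.natAbs : ℕ) : ℤ) = n := by omega
    rw [this, hne]

theorem ncard_H2pts {a b e : Fin 3 → ℤ} {n : ℕ} {c : ℤ} (hn : 0 < n)
    (hind : ∀ s t : ℝ, s • coe3 a + t • coe3 b = 0 → s = 0 ∧ t = 0)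
    (he : (n : ℤ) • e = a + c • b)
    (hs : ∀ x ∈ planeSubgroup (coe3 a) (coe3 b), ∃ k m : ℤ, x = k • e + m • b) :
    (H2pts a b).ncard = n := by
  have hnR : (n : ℝ) ≠ 0 := by positivity
  have hnR' : (0 : ℝ) < n := by positivity
  have hnZ : (0 : ℤ) < n := by exact_mod_cast hn
  have hce : coe3 e = (1 / n : ℝ) • coe3 a + (c / n : ℝ) • coe3 b := by
    have h1 := congrArg coe3 he
    rw [coe3_add, coe3_smul, coe3_smul] at h1
    funext i
    have h2 := congrFun h1 i
    simp only [Pi.add_apply, Pi.smul_apply, smul_eq_mul, Int.cast_natCast] at h2 ⊢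
    field_simp
    linarith
  have hcoord : ∀ k m : ℤ, coe3 (k • e + m • b) =
      (k / n : ℝ) • coe3 a + ((k * c + m * n : ℤ) / n : ℝ) • coe3 b := by
    intro k m
    rw [coe3_add, coe3_smul, coe3_smul, hce]
    funext i
    simp only [Pi.add_apply, Pi.smul_apply, smul_eq_mul]
    push_cast
    field_simp
    ring
  have huniq : ∀ s t s' t' : ℝ, s • coe3 a + t • coe3 b = s' • coe3 a + t' • coe3 b →
      s = s' ∧ t = t' := by
    intro s t s' t' h
    have := hind (s - s') (t - t') (by
      rw [sub_smul, sub_smul, sub_add_sub_comm, h, sub_self])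
    exact ⟨sub_eq_zero.mp this.1, sub_eq_zero.mp this.2⟩
  let f : ℕ → (Fin 3 → ℤ) := fun k => (k : ℤ) • e + (-(k * c / n) : ℤ) • b
  have himg : H2pts a b = f '' (Finset.range n : Set ℕ) := by
    ext x
    constructor
    · rintro ⟨s, t, hs0, hs1, ht0, ht1, hx⟩
      obtain ⟨k, m, rfl⟩ := hs x ⟨s, t, hx⟩
      rw [hcoord] at hx
      obtain ⟨rfl, rfl⟩ := huniq _ _ _ _ hx
      rw [div_lt_one hnR'] at hs1 ht1
      have hs0' : (0 : ℝ) ≤ k := by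
        have := mul_nonneg hs0 hnR'.le
        rwa [div_mul_cancel₀ _ hnR] at this
      have ht0' : (0 : ℝ) ≤ (k * c + m * n : ℤ) := by
        have := mul_nonneg ht0 hnR'.le
        rwa [div_mul_cancel₀ _ hnR] at this
      have a1 : 0 ≤ k := by exact_mod_cast hs0'
      have a2 : k < n := by exact_mod_cast hs1
      have a3 : 0 ≤ k * c + m * n := by exact_mod_cast ht0'
      have a4 : k * c + m * n < n := by exact_mod_cast ht1
      lift k to ℕ using a1
      refine ⟨k, by simpa using a2, ?_⟩
      have : -((k : ℤ) * c / n) = m := by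
        have h1 : ((k : ℤ) * c + m * n) / n = 0 := Int.ediv_eq_zero_of_lt a3 a4
        rw [Int.add_mul_ediv_right _ _ hnZ.ne'] at h1
        omega
      simp only [f, this]
    · rintro ⟨k, hk, rfl⟩
      have hk' : k < n := by simpa using hk
      have hmod : (k : ℤ) * c + -((k : ℤ) * c / n) * n = (k : ℤ) * c % n := by
        rw [Int.emod_def]; ring
      refine ⟨_, _, ?_, ?_, ?_, ?_, hcoord _ _⟩
      · positivity
      · rw [div_lt_one hnR']; exact_mod_cast hk'
      · rw [hmod]
        have := Int.emod_nonneg ((k : ℤ) * c) hnZ.ne'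
        have : (0 : ℝ) ≤ ((k : ℤ) * c % n : ℤ) := by exact_mod_cast this
        positivity
      · rw [hmod, div_lt_one hnR']
        exact_mod_cast Int.emod_lt_of_pos ((k : ℤ) * c) hnZ
  rw [himg, Set.ncard_image_of_injOn, Set.ncard_coe_finset, Finset.card_range]
  intro k _ k' _ h
  have h1 := congrArg coe3 h
  simp only [f] at h1
  rw [hcoord, hcoord] at h1
  have := (huniq _ _ _ _ h1).1
  field_simp at this
  exact_mod_cast this

theorem mem_lattice3 {w₁ w₂ w₃ x : Fin 3 → ℤ} :
    x ∈ lattice3 w₁ w₂ w₃ ↔ ∃ p q r : ℤ, x = p • w₁ + q • w₂ + r • w₃ := by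
  constructor
  · intro h
    induction h using AddSubgroup.closure_induction with
    | mem x hx =>
      rcases hx with rfl | rfl | rfl
      · exact ⟨1, 0, 0, by simp⟩
      · exact ⟨0, 1, 0, by simp⟩
      · exact ⟨0, 0, 1, by simp⟩
    | zero => exact ⟨0, 0, 0, by simp⟩
    | add x y _ _ hx hy =>
      obtain ⟨p, q, r, rfl⟩ := hx
      obtain ⟨p', q', r', rfl⟩ := hy
      exact ⟨p + p', q + q', r + r', by module⟩
    | neg x _ hx =>
      obtain ⟨p, q, r, rfl⟩ := hx
      exact ⟨-p, -q, -r, by module⟩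
  · rintro ⟨p, q, r, rfl⟩
    unfold lattice3
    refine add_mem (add_mem ?_ ?_) ?_ <;> apply AddSubgroup.zsmul_mem <;>
      apply AddSubgroup.subset_closure <;> simp

theorem mem_plane_of_int {a b x : Fin 3 → ℤ} {n p q : ℤ} (hn : n ≠ 0)
    (h : n • x = p • a + q • b) : x ∈ planeSubgroup (coe3 a) (coe3 b) := by
  refine ⟨p / n, q / n, ?_⟩
  have hnR : (n : ℝ) ≠ 0 := by exact_mod_cast hn
  have h1 := congrArg coe3 h
  rw [coe3_add, coe3_smul, coe3_smul, coe3_smul] at h1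
  funext i
  have h2 := congrFun h1 i
  simp only [Pi.add_apply, Pi.smul_apply, smul_eq_mul] at h2 ⊢
  field_simp
  linarith

/-- The subgroup `(K₁ + K₂) ∩ K₃` of `G` contains exactly `gcd(μ₁, μ₂)`
elements; moreover it is cyclic, generated by the class of `(1/γ)·w₁ + (ξ_γ/γ)·w₂` for a
unique `ξ_γ ∈ {0,…,γ−1}` coprime to `γ`, where `γ = gcd(μ₁, μ₂)`. -/
theorem K1_plus_K2_inter_K3 (w₁ w₂ w₃ : Fin 3 → ℤ)
    (hnn₁ : ∀ i, 0 ≤ w₁ i) (hnn₂ : ∀ i, 0 ≤ w₂ i) (hnn₃ : ∀ i, 0 ≤ w₃ i)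
    (hp₁ : IsPrimitive w₁) (hp₂ : IsPrimitive w₂) (hp₃ : IsPrimitive w₃)
    (hli : LinearIndependent ℝ ![coe3 w₁, coe3 w₂, coe3 w₃])
    (μ₁ μ₂ γ : ℕ) (hμ₁ : μ₁ = (H2pts w₂ w₃).ncard) (hμ₂ : μ₂ = (H2pts w₁ w₃).ncard)
    (hγ : γ = Nat.gcd μ₁ μ₂) :
    Nat.card ↥((Ksub w₁ w₂ w₃ w₂ w₃ ⊔ Ksub w₁ w₂ w₃ w₁ w₃) ⊓ Ksub w₁ w₂ w₃ w₁ w₂) = γ ∧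
    ∃! ξ : ℕ, ξ < γ ∧ Nat.gcd ξ γ = 1 ∧
      ∃ u : Fin 3 → ℤ, (γ : ℤ) • u = w₁ + (ξ : ℤ) • w₂ ∧
        (Ksub w₁ w₂ w₃ w₂ w₃ ⊔ Ksub w₁ w₂ w₃ w₁ w₃) ⊓ Ksub w₁ w₂ w₃ w₁ w₂ =
          AddSubgroup.closure {QuotientAddGroup.mk' (lattice3 w₁ w₂ w₃) u} := by
  have hR : ∀ p q r : ℝ, p • coe3 w₁ + q • coe3 w₂ + r • coe3 w₃ = 0 → p = 0 ∧ q = 0 ∧ r = 0 := by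
    intro p q r h
    have := Fintype.linearIndependent_iff.mp hli ![p, q, r] (by
      simpa [Fin.sum_univ_three] using h)
    exact ⟨this 0, this 1, this 2⟩
  have hZ : ∀ p q r : ℤ, p • w₁ + q • w₂ + r • w₃ = 0 → p = 0 ∧ q = 0 ∧ r = 0 := by
    intro p q r h
    have h1 := congrArg coe3 h
    rw [coe3_add, coe3_add, coe3_smul, coe3_smul, coe3_smul] at h1
    have h0 : coe3 0 = 0 := by funext i; simp [coe3]
    rw [h0] at h1
    have := hR _ _ _ h1
    exact_mod_cast this
  have hind1 : ∀ s t : ℝ, s • coe3 w₂ + t • coe3 w₃ = 0 → s = 0 ∧ t = 0 := by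
    intro s t h
    have := hR 0 s t (by rw [zero_smul, zero_add, h])
    exact this.2
  have hind2 : ∀ s t : ℝ, s • coe3 w₁ + t • coe3 w₃ = 0 → s = 0 ∧ t = 0 := by
    intro s t h
    have := hR s 0 t (by rw [zero_smul, add_zero, h])
    exact ⟨this.1, this.2.2⟩
  obtain ⟨n1, e1, c1, hn1, he1, hs1⟩ := plane_basis hp₂ hp₃ hind1
  obtain ⟨n2, e2, c2, hn2, he2, hs2⟩ := plane_basis hp₁ hp₃ hind2
  rw [ncard_H2pts hn1 hind1 he1 hs1] at hμ₁
  rw [ncard_H2pts hn2 hind2 he2 hs2] at hμ₂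
  subst hμ₁ hμ₂
  have hγ0 : 0 < γ := by rw [hγ]; exact Nat.gcd_pos_of_pos_left _ hn1
  have hγZ : (γ : ℤ) ≠ 0 := by exact_mod_cast hγ0.ne'
  obtain ⟨m1, hm1⟩ : γ ∣ μ₁ := hγ ▸ Nat.gcd_dvd_left _ _
  obtain ⟨m2, hm2⟩ : γ ∣ μ₂ := hγ ▸ Nat.gcd_dvd_right _ _
  have hm : IsCoprime (m1 : ℤ) (m2 : ℤ) := by
    rw [Nat.isCoprime_iff_coprime]
    have h : γ * Nat.gcd m1 m2 = γ * 1 := by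
      rw [← Nat.gcd_mul_left, ← hm1, ← hm2, mul_one, hγ]
    exact Nat.eq_of_mul_eq_mul_left hγ0 h
  have hc1 := prim_coprime hp₂ he1
  have hc2 := prim_coprime hp₁ he2
  have hm1Z : (μ₁ : ℤ) = γ * m1 := by exact_mod_cast hm1
  have hm2Z : (μ₂ : ℤ) = γ * m2 := by exact_mod_cast hm2
  have hμ1 : (μ₁ : ℤ) ≠ 0 := by exact_mod_cast hn1.ne'
  have hμ2 : (μ₂ : ℤ) ≠ 0 := by exact_mod_cast hn2.ne'
  have hm10 : (m1 : ℤ) ≠ 0 := by intro h; rw [h, mul_zero] at hm1Z; exact hμ1 hm1Z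
  have hm20 : (m2 : ℤ) ≠ 0 := by intro h; rw [h, mul_zero] at hm2Z; exact hμ2 hm2Z
  rw [hm1Z] at hc1 he1 hμ1
  rw [hm2Z] at hc2 he2 hμ2
  have hc1γ : IsCoprime c1 γ := hc1.of_mul_right_left
  have hc1m : IsCoprime c1 m1 := hc1.of_mul_right_right
  have hc2m : IsCoprime c2 m2 := hc2.of_mul_right_right
  obtain ⟨f1, hf1⟩ : ∃ f1, f1 = (m1 : ℤ) • e1 := ⟨_, rfl⟩
  obtain ⟨f2, hf2⟩ : ∃ f2, f2 = (m2 : ℤ) • e2 := ⟨_, rfl⟩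
  have hγf1 : (γ : ℤ) • f1 = w₂ + c1 • w₃ := by rw [hf1, smul_smul, he1]
  have hγf2 : (γ : ℤ) • f2 = w₁ + c2 • w₃ := by rw [hf2, smul_smul, he2]
  -- choose ξ
  obtain ⟨ξ, hξlt, z, hz⟩ : ∃ ξ : ℕ, ξ < γ ∧ (γ : ℤ) ∣ c2 + ξ * c1 := by
    obtain ⟨α, β, hαβ⟩ := hc1γ
    have hpos : (0 : ℤ) < γ := by exact_mod_cast hγ0
    have h0 := Int.emod_nonneg (-c2 * α) hγZ
    have h1 := Int.emod_lt_of_pos (-c2 * α) hpos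
    have h2 := Int.emod_def (-c2 * α) γ
    generalize (-c2 * α) % γ = y at h0 h1 h2
    lift y to ℕ using h0
    refine ⟨y, by exact_mod_cast h1, c2 * β - (-c2 * α / γ) * c1, ?_⟩
    rw [h2]
    linear_combination (-c2) * hαβ
  obtain ⟨u, hu⟩ : ∃ u, u = f2 + (ξ : ℤ) • f1 - z • w₃ := ⟨_, rfl⟩
  have hγu : (γ : ℤ) • u = w₁ + (ξ : ℤ) • w₂ := by
    have : (γ : ℤ) • u = (γ : ℤ) • f2 + (ξ : ℤ) • ((γ : ℤ) • f1) - ((γ : ℤ) * z) • w₃ := by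
      rw [hu]; module
    rw [this, hγf1, hγf2, ← hz]; module
  have hw1 : w₁ ∈ lattice3 w₁ w₂ w₃ := mem_lattice3.mpr ⟨1, 0, 0, by simp⟩
  have hw2 : w₂ ∈ lattice3 w₁ w₂ w₃ := mem_lattice3.mpr ⟨0, 1, 0, by simp⟩
  have hw3 : w₃ ∈ lattice3 w₁ w₂ w₃ := mem_lattice3.mpr ⟨0, 0, 1, by simp⟩
  have hgen : (Ksub w₁ w₂ w₃ w₂ w₃ ⊔ Ksub w₁ w₂ w₃ w₁ w₃) ⊓ Ksub w₁ w₂ w₃ w₁ w₂ =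
          AddSubgroup.closure {QuotientAddGroup.mk' (lattice3 w₁ w₂ w₃) u} := by
    apply le_antisymm
    · rintro g ⟨hg12, hg3⟩
      obtain ⟨g1, ⟨x1, hx1, rfl⟩, g2, ⟨x2, hx2, rfl⟩, rfl⟩ := AddSubgroup.mem_sup.mp hg12
      obtain ⟨x3, ⟨s, t, hx3⟩, heq⟩ := hg3
      obtain ⟨i, k1, rfl⟩ := hs1 x1 hx1
      obtain ⟨j, k2, rfl⟩ := hs2 x2 hx2
      rw [← map_add] at heq ⊢
      have hmem : -x3 + (i • e1 + k1 • w₃ + (j • e2 + k2 • w₃)) ∈ lattice3 w₁ w₂ w₃ :=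
        QuotientAddGroup.eq.mp heq
      obtain ⟨p, q, r', hpqr⟩ := mem_lattice3.mp hmem
      -- isolate `x3`
      have hx3' : x3 = i • e1 + j • e2 + (-p) • w₁ + (-q) • w₂ + (k1 + k2 - r') • w₃ := by
        have : x3 = (i • e1 + k1 • w₃ + (j • e2 + k2 • w₃)) - (p • w₁ + q • w₂ + r' • w₃) := by
          rw [← hpqr]; abel
        rw [this]; module
      obtain ⟨r, hr⟩ : ∃ r, r = k1 + k2 - r' := ⟨_, rfl⟩
      rw [← hr] at hx3'
      have hkey : i * c1 * m2 + j * c2 * m1 + r * γ * m1 * m2 = 0 := by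
        have h1 : (γ * m1 * m2 : ℤ) • x3 = (j * m1 - γ * m1 * m2 * p) • w₁
            + (i * m2 - γ * m1 * m2 * q) • w₂
            + (i * c1 * m2 + j * c2 * m1 + r * γ * m1 * m2) • w₃ := by
          have : (γ * m1 * m2 : ℤ) • x3 = (i * m2) • ((γ * m1 : ℤ) • e1)
              + (j * m1) • ((γ * m2 : ℤ) • e2)
              + (γ * m1 * m2 : ℤ) • ((-p) • w₁ + (-q) • w₂ + r • w₃) := by
            rw [hx3']; module
          rw [this, he1, he2]; module
        have h2 := congrArg coe3 h1
        rw [coe3_add, coe3_add, coe3_smul, coe3_smul, coe3_smul, coe3_smul, hx3] at h2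
        obtain ⟨D, hD⟩ : ∃ D : ℝ, D = ((γ * m1 * m2 : ℤ) : ℝ) := ⟨_, rfl⟩
        obtain ⟨A, hA⟩ : ∃ D : ℝ, D = ((j * m1 - γ * m1 * m2 * p : ℤ) : ℝ) := ⟨_, rfl⟩
        obtain ⟨B, hB⟩ : ∃ D : ℝ, D = ((i * m2 - γ * m1 * m2 * q : ℤ) : ℝ) := ⟨_, rfl⟩
        obtain ⟨C, hC⟩ : ∃ D : ℝ, D = ((i * c1 * m2 + j * c2 * m1 + r * γ * m1 * m2 : ℤ) : ℝ) :=
          ⟨_, rfl⟩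
        rw [← hD, ← hA, ← hB, ← hC] at h2
        have h3 := (hR (A - D * s) (B - D * t) C (by
          have : (A - D * s) • coe3 w₁ + (B - D * t) • coe3 w₂ + C • coe3 w₃ =
            (A • coe3 w₁ + B • coe3 w₂ + C • coe3 w₃) - D • (s • coe3 w₁ + t • coe3 w₂) := by
              module
          rw [this, h2, sub_self])).2.2
        rw [hC] at h3
        exact_mod_cast h3
      obtain ⟨i', rfl⟩ : (m1 : ℤ) ∣ i := by
        have h : (m1 : ℤ) ∣ i * (c1 * m2) :=
          ⟨-(j * c2 + r * γ * m2), by linear_combination hkey⟩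
        exact (hc1m.symm.mul_right hm).dvd_of_dvd_mul_right h
      obtain ⟨j', rfl⟩ : (m2 : ℤ) ∣ j := by
        have h : (m2 : ℤ) ∣ j * (c2 * m1) :=
          ⟨-(m1 * i' * c1 + r * γ * m1), by linear_combination hkey⟩
        exact (hc2m.symm.mul_right hm.symm).dvd_of_dvd_mul_right h
      have hkey2 : i' * c1 + j' * c2 + r * γ = 0 := by
        have : (m1 * m2 : ℤ) * (i' * c1 + j' * c2 + r * γ) = 0 := by linear_combination hkey
        rcases mul_eq_zero.mp this with h | h
        · exact absurd h (mul_ne_zero hm10 hm20)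
        · exact h
      obtain ⟨l, hl⟩ : (γ : ℤ) ∣ i' - j' * ξ := by
        have h : (γ : ℤ) ∣ (i' - j' * ξ) * c1 :=
          ⟨-(r + j' * z), by linear_combination hkey2 - j' * hz⟩
        exact hc1γ.symm.dvd_of_dvd_mul_right h
      have hi' : i' = j' * ξ + γ * l := by linear_combination hl
      rw [AddSubgroup.mem_closure_singleton]
      refine ⟨j', ?_⟩
      rw [← map_zsmul]
      refine QuotientAddGroup.eq.mpr ?_
      apply mem_lattice3.mpr
      refine ⟨0, l, l * c1 + j' * z + k1 + k2, ?_⟩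
      have h1 : -(j' • u) + (((m1 : ℤ) * i') • e1 + k1 • w₃ + (((m2 : ℤ) * j') • e2 + k2 • w₃)) =
          l • ((γ : ℤ) • f1) + (j' * z + k1 + k2) • w₃ := by
        rw [hu, hf1, hf2, hi']; module
      rw [h1, hγf1]; module
    · rw [AddSubgroup.closure_le, Set.singleton_subset_iff]
      refine ⟨?_, ?_⟩
      · refine AddSubgroup.mem_sup.mpr
          ⟨_, ⟨(ξ : ℤ) • f1, ?_, rfl⟩, _, ⟨f2 - z • w₃, ?_, rfl⟩, ?_⟩
        · apply mem_plane_of_int hγZ (p := ξ) (q := ξ * c1)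
          rw [smul_comm, hγf1]; module
        · apply mem_plane_of_int hγZ (p := 1) (q := c2 - γ * z)
          rw [smul_sub, hγf2]; module
        · rw [← map_add, hu]; congr 1; abel
      · refine ⟨u, ?_, rfl⟩
        apply mem_plane_of_int hγZ (p := 1) (q := ξ)
        rw [hγu, one_smul]
  refine ⟨?_, ξ, ⟨hξlt, ?_, u, hγu, hgen⟩, ?_⟩
  · rw [hgen, ← AddSubgroup.zmultiples_eq_closure, Nat.card_zmultiples]
    apply Nat.dvd_antisymm
    · apply addOrderOf_dvd_of_nsmul_eq_zero
      rw [← map_nsmul]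
      refine (QuotientAddGroup.eq_zero_iff _).mpr (mem_lattice3.mpr ⟨1, ξ, 0, ?_⟩)
      rw [← natCast_zsmul, hγu]; simp
    · have h := addOrderOf_nsmul_eq_zero (QuotientAddGroup.mk' (lattice3 w₁ w₂ w₃) u)
      generalize addOrderOf (QuotientAddGroup.mk' (lattice3 w₁ w₂ w₃) u) = k at h
      rw [← map_nsmul] at h
      obtain ⟨p, q, r, hp⟩ := mem_lattice3.mp ((QuotientAddGroup.eq_zero_iff _).mp h)
      rw [← natCast_zsmul] at hp
      have h1 : (k : ℤ) • ((γ : ℤ) • u) = (γ : ℤ) • (p • w₁ + q • w₂ + r • w₃) := by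
        rw [smul_comm, hp]
      rw [hγu] at h1
      have h2 := (hZ (k - γ * p) (k * ξ - γ * q) (-(γ * r)) (by
        have : ((k : ℤ) - γ * p) • w₁ + (k * ξ - γ * q : ℤ) • w₂ + (-(γ * r) : ℤ) • w₃ =
          (k : ℤ) • (w₁ + (ξ : ℤ) • w₂) - (γ : ℤ) • (p • w₁ + q • w₂ + r • w₃) := by module
        rw [this, h1, sub_self])).1
      have : (γ : ℤ) ∣ k := ⟨p, by linarith⟩
      exact_mod_cast this
  · exact Nat.isCoprime_iff_coprime.mp (prim_coprime hp₁ hγu)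
  · rintro ξ' ⟨hlt, -, u', hu', -⟩
    have hdvd : (γ : ℤ) ∣ (ξ' : ℤ) - ξ := by
      apply prim_int (v := u' - u) hp₂
      rw [smul_sub, hu', hγu]; module
    have := Int.eq_zero_of_abs_lt_dvd hdvd (by rw [abs_lt]; constructor <;> omega)
    omega

end
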